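/- In the trousers Morse geometry, let q lie in the upper future component F₁ = {(x,y) ∈ N : y > m₂|x|} (so that u(q) < 0 and v(q) < 0). Then I⁺(q) = {p = (p₁,p₂) ∈ N : p₂ > 0, u(p) < u(q) and v(p) < v(q)} (which is contained in F₁), and I⁻(q) = {p ∈ N : u(p) > u(q) and v(p) > v(q)} \ {p = (p₁,p₂) ∈ N : p₂ ≤ 0 and |p₂| ≥ m₁|p₁|}; in particular I⁻(q) contains the whole past region P = {(x,y) ∈ N : |y| < m₁|x|} but contains no point of the lower future component F₂ = {(x,y) ∈ N : y < −m₂|x|}. -/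

import Mathlib

noncomputable section

open Set

/-- The punctured disc `N = {(x,y) : 0 < x² + y² < ε²}`. -/
def N2 (ε : ℝ) : Set (ℝ × ℝ) :=
  {p | 0 < p.1 ^ 2 + p.2 ^ 2 ∧ p.1 ^ 2 + p.2 ^ 2 < ε ^ 2}

/-- The trousers Morse metric (quadratic form) built from `f(x,y) = y² − x²`. -/
def g2 (ζ : ℝ) (p w : ℝ × ℝ) : ℝ :=
  4 * ((p.2 ^ 2 - (ζ - 1) * p.1 ^ 2) * w.1 ^ 2 + 2 * ζ * p.1 * p.2 * w.1 * w.2 +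
    (p.1 ^ 2 - (ζ - 1) * p.2 ^ 2) * w.2 ^ 2)

/-- The null coordinate `u(x,y) = √(ζ−1)(x²−y²) + 2xy`. -/
def uu (ζ : ℝ) (p : ℝ × ℝ) : ℝ :=
  Real.sqrt (ζ - 1) * (p.1 ^ 2 - p.2 ^ 2) + 2 * p.1 * p.2

/-- The null coordinate `v(x,y) = √(ζ−1)(x²−y²) − 2xy`. -/
def vv (ζ : ℝ) (p : ℝ × ℝ) : ℝ :=
  Real.sqrt (ζ - 1) * (p.1 ^ 2 - p.2 ^ 2) - 2 * p.1 * p.2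

def m1 (ζ : ℝ) : ℝ := (Real.sqrt ζ - 1) / Real.sqrt (ζ - 1)
def m2 (ζ : ℝ) : ℝ := (Real.sqrt ζ + 1) / Real.sqrt (ζ - 1)

/-- A future-directed timelike curve: a C¹ curve in `N` with everywhere timelike,
future-pointing tangent (`⟨∇f(γ), γ'⟩ = −2xγ₁' + 2yγ₂' > 0` where `f = y² − x²`). -/
def Timelike2 (ζ ε : ℝ) (γ γ' : ℝ → ℝ × ℝ) : Prop :=
  (∀ t ∈ Icc (0 : ℝ) 1, HasDerivAt γ (γ' t) t) ∧
  ContinuousOn γ' (Icc (0 : ℝ) 1) ∧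
  (∀ t ∈ Icc (0 : ℝ) 1, γ t ∈ N2 ε) ∧
  (∀ t ∈ Icc (0 : ℝ) 1, g2 ζ (γ t) (γ' t) < 0) ∧
  (∀ t ∈ Icc (0 : ℝ) 1, 0 < -2 * (γ t).1 * (γ' t).1 + 2 * (γ t).2 * (γ' t).2)

/-- The chronology relation `q ≪ p`. -/
def chron2 (ζ ε : ℝ) (q p : ℝ × ℝ) : Prop :=
  ∃ γ γ', Timelike2 ζ ε γ γ' ∧ γ 0 = q ∧ γ 1 = p

def Iplus2 (ζ ε : ℝ) (q : ℝ × ℝ) : Set (ℝ × ℝ) := {p ∈ N2 ε | chron2 ζ ε q p}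

def Iminus2 (ζ ε : ℝ) (q : ℝ × ℝ) : Set (ℝ × ℝ) := {p ∈ N2 ε | chron2 ζ ε p q}

/-- The common past `↓U` (interior in the open set `N` of the set of points
chronologically preceding every point of `U`). -/
def down2 (ζ ε : ℝ) (U : Set (ℝ × ℝ)) : Set (ℝ × ℝ) :=
  interior {p ∈ N2 ε | ∀ u ∈ U, chron2 ζ ε p u}

/-- Lifting lemma: a curve in the `z²`-plane avoiding the ray `A = 0, B ≤ 0`. -/
lemma lift_curve (ζ ε : ℝ) (hζ : 1 < ζ) (hε : 0 < ε) (p q : ℝ × ℝ)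
    (hp : 0 < p.1 + p.2) (hq : 0 < q.1 + q.2) (A B A' B' : ℝ → ℝ)
    (hA : ∀ t, HasDerivAt A (A' t) t) (hB : ∀ t, HasDerivAt B (B' t) t)
    (cA : Continuous A') (cB : Continuous B')
    (h0A : A 0 = p.1 ^ 2 - p.2 ^ 2) (h0B : B 0 = 2 * p.1 * p.2)
    (h1A : A 1 = q.1 ^ 2 - q.2 ^ 2) (h1B : B 1 = 2 * q.1 * q.2)
    (hE : ∀ t ∈ Icc (0 : ℝ) 1, A t ^ 2 + B t ^ 2 < ε ^ 4)
    (hs : ∀ t ∈ Icc (0 : ℝ) 1, A t = 0 → 0 < B t)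
    (hu : ∀ t ∈ Icc (0 : ℝ) 1, Real.sqrt (ζ - 1) * A' t + B' t < 0)
    (hv : ∀ t ∈ Icc (0 : ℝ) 1, Real.sqrt (ζ - 1) * A' t - B' t < 0) :
    chron2 ζ ε p q := by
  set R : ℝ → ℝ := fun t => Real.sqrt (A t ^ 2 + B t ^ 2) with hR
  set X : ℝ → ℝ := fun t => Real.sqrt (R t + B t) with hX
  set x : ℝ → ℝ := fun t => (X t + A t / X t) / 2 with hx
  set y : ℝ → ℝ := fun t => (X t - A t / X t) / 2 with hy
  have R2 : ∀ t, R t ^ 2 = A t ^ 2 + B t ^ 2 := fun t => Real.sq_sqrt (by positivity)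
  have R0 : ∀ t, 0 ≤ R t := fun t => Real.sqrt_nonneg _
  have cAf : Continuous A := continuous_iff_continuousAt.2 fun t => (hA t).continuousAt
  have cBf : Continuous B := continuous_iff_continuousAt.2 fun t => (hB t).continuousAt
  have cR : Continuous R := by simp only [hR]; fun_prop
  have good : ∀ t ∈ Icc (0 : ℝ) 1, 0 < R t + B t := by
    intro t ht
    by_contra hcon
    have h1 := R2 t
    have h2 := R0 t
    have hB0 : B t ≤ 0 := by linarith
    have hA0 : A t ^ 2 ≤ 0 := by nlinarith
    have hA1 : A t = 0 := by nlinarith [sq_nonneg (A t), pow_eq_zero_iff (M₀ := ℝ) (a := A t) (n := 2) (by norm_num), le_antisymm hA0 (sq_nonneg (A t))]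
    have := hs t ht hA1
    linarith
  have X2 : ∀ t, 0 < R t + B t → X t ^ 2 = R t + B t := fun t ht => Real.sq_sqrt ht.le
  have X0 : ∀ t, 0 < R t + B t → 0 < X t := fun t ht => Real.sqrt_pos.2 ht
  have eA : ∀ t, 0 < R t + B t → x t ^ 2 - y t ^ 2 = A t := by
    intro t ht
    have := (X0 t ht).ne'
    simp only [hx, hy]
    field_simp
    ring
  have eR : ∀ t, 0 < R t + B t → x t ^ 2 + y t ^ 2 = R t := by
    intro t ht
    have h0 := (X0 t ht).ne'
    have e1 : x t ^ 2 + y t ^ 2 = (X t ^ 2 + A t ^ 2 / X t ^ 2) / 2 := by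
      simp only [hx, hy]; field_simp; ring
    rw [e1, X2 t ht]
    have h1 := R2 t
    field_simp
    linarith
  have eB : ∀ t, 0 < R t + B t → 2 * x t * y t = B t := by
    intro t ht
    have h0 := (X0 t ht).ne'
    have e1 : 2 * x t * y t = (X t ^ 2 - A t ^ 2 / X t ^ 2) / 2 := by
      simp only [hx, hy]; field_simp; ring
    rw [e1, X2 t ht]
    have h1 := R2 t
    field_simp
    linarith
  have Rpos : ∀ t, 0 < R t + B t → 0 < R t := by
    intro t ht
    rcases (R0 t).lt_or_eq with h | h
    · exact h
    · have h1 := R2 t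
      rw [← h] at h1 ht
      nlinarith [sq_nonneg (A t)]
  have dX : ∀ t, 0 < R t + B t → DifferentiableAt ℝ X t := by
    intro t ht
    have hAd := (hA t).differentiableAt
    have hBd := (hB t).differentiableAt
    have hRd : DifferentiableAt ℝ R t := by
      apply DifferentiableAt.sqrt
      · fun_prop
      · rw [← R2 t]; have := Rpos t ht; positivity
    exact DifferentiableAt.sqrt (hRd.add hBd) ht.ne'
  have dx : ∀ t, 0 < R t + B t → DifferentiableAt ℝ x t := by
    intro t ht
    exact ((dX t ht).add ((hA t).differentiableAt.div (dX t ht) (X0 t ht).ne')).div_const 2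
  have dy : ∀ t, 0 < R t + B t → DifferentiableAt ℝ y t := by
    intro t ht
    exact ((dX t ht).sub ((hA t).differentiableAt.div (dX t ht) (X0 t ht).ne')).div_const 2
  have ev : ∀ t, 0 < R t + B t → ∀ᶠ τ in nhds t, 0 < R τ + B τ := by
    intro t ht
    exact (cR.add cBf).continuousAt.eventually (lt_mem_nhds ht)
  have da : ∀ t, 0 < R t + B t → 2 * (x t * deriv x t - y t * deriv y t) = A' t := by
    intro t ht
    have h1 : HasDerivAt (fun τ => x τ ^ 2 - y τ ^ 2) (A' t) t :=
      (hA t).congr_of_eventuallyEq ((ev t ht).mono fun τ hτ => eA τ hτ)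
    have h2 := ((dx t ht).hasDerivAt.pow 2).sub ((dy t ht).hasDerivAt.pow 2)
    have h3 := h1.unique h2
    rw [h3]; norm_num; ring
  have db : ∀ t, 0 < R t + B t → 2 * (x t * deriv y t + y t * deriv x t) = B' t := by
    intro t ht
    have h1 : HasDerivAt (fun τ => 2 * (x τ * y τ)) (B' t) t :=
      (hB t).congr_of_eventuallyEq ((ev t ht).mono fun τ hτ => by
        have := eB τ hτ
        simp only []
        linarith)
    have h2 := ((dx t ht).hasDerivAt.mul (dy t ht).hasDerivAt).const_mul 2
    have h3 := h1.unique h2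
    rw [h3]; ring
  have sx : ∀ t, 0 < R t + B t → deriv x t = (x t * A' t + y t * B' t) / (2 * R t) := by
    intro t ht
    have := Rpos t ht
    rw [eq_div_iff (by positivity), ← da t ht, ← db t ht, ← eR t ht]; ring
  have sy : ∀ t, 0 < R t + B t → deriv y t = (x t * B' t - y t * A' t) / (2 * R t) := by
    intro t ht
    have := Rpos t ht
    rw [eq_div_iff (by positivity), ← da t ht, ← db t ht, ← eR t ht]; ring
  have cx : ContinuousOn x (Icc 0 1) := fun t ht =>
    (dx t (good t ht)).continuousAt.continuousWithinAt
  have cy : ContinuousOn y (Icc 0 1) := fun t ht =>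
    (dy t (good t ht)).continuousAt.continuousWithinAt
  have s0 : 0 < Real.sqrt (ζ - 1) := Real.sqrt_pos.2 (by linarith)
  have s2 : Real.sqrt (ζ - 1) ^ 2 = ζ - 1 := Real.sq_sqrt (by linarith)
  have endp : ∀ (t : ℝ) (r : ℝ × ℝ), 0 < r.1 + r.2 → A t = r.1 ^ 2 - r.2 ^ 2 →
      B t = 2 * r.1 * r.2 → (x t, y t) = r := by
    intro t r hr h1 h2
    have e1 : R t = r.1 ^ 2 + r.2 ^ 2 := by
      simp only [hR]
      rw [h1, h2, show (r.1 ^ 2 - r.2 ^ 2) ^ 2 + (2 * r.1 * r.2) ^ 2 = (r.1 ^ 2 + r.2 ^ 2) ^ 2 by ring]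
      exact Real.sqrt_sq (by positivity)
    have e2 : X t = r.1 + r.2 := by
      simp only [hX]
      rw [e1, h2, show r.1 ^ 2 + r.2 ^ 2 + 2 * r.1 * r.2 = (r.1 + r.2) ^ 2 by ring]
      exact Real.sqrt_sq hr.le
    have e3 : A t / X t = r.1 - r.2 := by
      rw [e2, h1, div_eq_iff hr.ne']; ring
    ext
    · simp only [hx]; rw [e3, e2]; ring
    · simp only [hy]; rw [e3, e2]; ring
  refine ⟨fun t => (x t, y t), fun t => (deriv x t, deriv y t), ⟨?_, ?_, ?_, ?_, ?_⟩, ?_, ?_⟩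
  · intro t ht
    exact (dx t (good t ht)).hasDerivAt.prodMk (dy t (good t ht)).hasDerivAt
  · apply ContinuousOn.prodMk
    · apply ContinuousOn.congr (f := fun t => (x t * A' t + y t * B' t) / (2 * R t))
      · apply ContinuousOn.div
        · exact (cx.mul cA.continuousOn).add (cy.mul cB.continuousOn)
        · exact (continuous_const.mul cR).continuousOn
        · intro t ht; have := Rpos t (good t ht); positivity
      · intro t ht; exact sx t (good t ht)
    · apply ContinuousOn.congr (f := fun t => (x t * B' t - y t * A' t) / (2 * R t))
      · apply ContinuousOn.div
        · exact (cx.mul cB.continuousOn).sub (cy.mul cA.continuousOn)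
        · exact (continuous_const.mul cR).continuousOn
        · intro t ht; have := Rpos t (good t ht); positivity
      · intro t ht; exact sy t (good t ht)
  · intro t ht
    have h1 := eR t (good t ht)
    have h2 := Rpos t (good t ht)
    refine ⟨by simp only []; linarith, ?_⟩
    simp only []
    rw [h1]
    have h3 := hE t ht
    rw [← R2 t] at h3
    exact lt_of_pow_lt_pow_left₀ 2 (by positivity) (by linarith [show (ε ^ 2) ^ 2 = ε ^ 4 by ring])
  · intro t ht
    have h1 := da t (good t ht)
    have h2 := db t (good t ht)
    have h3 := mul_pos_of_neg_of_neg (hu t ht) (hv t ht)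
    have h4 : g2 ζ (x t, y t) (deriv x t, deriv y t) =
        (B' t) ^ 2 - (ζ - 1) * (A' t) ^ 2 := by
      rw [← h1, ← h2]; simp only [g2]; ring
    rw [h4]
    rw [← s2]; nlinarith
  · intro t ht
    have h1 := da t (good t ht)
    have h2 : A' t < 0 := by
      have := hu t ht
      have := hv t ht
      by_contra hc
      push Not at hc
      nlinarith [mul_nonneg s0.le hc]
    simp only []
    linarith
  · exact endp 0 p hp h0A h0B
  · exact endp 1 q hq h1A h1B

lemma mirror_chron (ζ ε : ℝ) (p q : ℝ × ℝ) (h : chron2 ζ ε (-p.1, p.2) (-q.1, q.2)) :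
    chron2 ζ ε p q := by
  obtain ⟨γ, γ', ⟨h1, h2, h3, h4, h5⟩, h6, h7⟩ := h
  refine ⟨fun t => (-(γ t).1, (γ t).2), fun t => (-(γ' t).1, (γ' t).2), ⟨?_, ?_, ?_, ?_, ?_⟩, ?_, ?_⟩
  · intro t ht
    have h := h1 t ht
    exact (hasFDerivAt_fst.comp_hasDerivAt t h).neg.prodMk (hasFDerivAt_snd.comp_hasDerivAt t h)
  · exact (continuous_fst.comp_continuousOn h2).neg.prodMk (continuous_snd.comp_continuousOn h2)
  · intro t ht
    have := h3 t ht
    simpa [N2] using this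
  · intro t ht
    have := h4 t ht
    simp only [g2] at this ⊢
    nlinarith
  · intro t ht
    have := h5 t ht
    simp only [] at this ⊢
    linarith
  · simp [h6]
  · simp [h7]

lemma conv3 (E α β γ a1 b1 a2 b2 a3 b3 : ℝ) (hα : 0 ≤ α) (hβ : 0 ≤ β) (hγ : 0 ≤ γ)
    (hsum : α + β + γ = 1) (h1 : a1 ^ 2 + b1 ^ 2 < E) (h2 : a2 ^ 2 + b2 ^ 2 < E)
    (h3 : a3 ^ 2 + b3 ^ 2 < E) :
    (α * a1 + β * a2 + γ * a3) ^ 2 + (α * b1 + β * b2 + γ * b3) ^ 2 < E := by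
  have key : (α * a1 + β * a2 + γ * a3) ^ 2 + (α * b1 + β * b2 + γ * b3) ^ 2 ≤
      α * (a1 ^ 2 + b1 ^ 2) + β * (a2 ^ 2 + b2 ^ 2) + γ * (a3 ^ 2 + b3 ^ 2) := by
    have hb : α = 1 - β - γ := by linarith
    have e : α * (a1 ^ 2 + b1 ^ 2) + β * (a2 ^ 2 + b2 ^ 2) + γ * (a3 ^ 2 + b3 ^ 2) -
      ((α * a1 + β * a2 + γ * a3) ^ 2 + (α * b1 + β * b2 + γ * b3) ^ 2) =
      α * β * ((a1 - a2) ^ 2 + (b1 - b2) ^ 2) + α * γ * ((a1 - a3) ^ 2 + (b1 - b3) ^ 2) +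
      β * γ * ((a2 - a3) ^ 2 + (b2 - b3) ^ 2) := by
      rw [hb]; ring
    have : 0 ≤ α * β * ((a1 - a2) ^ 2 + (b1 - b2) ^ 2) + α * γ * ((a1 - a3) ^ 2 + (b1 - b3) ^ 2) +
      β * γ * ((a2 - a3) ^ 2 + (b2 - b3) ^ 2) := by positivity
    linarith
  set M := max (a1 ^ 2 + b1 ^ 2) (max (a2 ^ 2 + b2 ^ 2) (a3 ^ 2 + b3 ^ 2)) with hM
  have hME : M < E := max_lt h1 (max_lt h2 h3)
  have m1' : a1 ^ 2 + b1 ^ 2 ≤ M := le_max_left _ _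
  have m2' : a2 ^ 2 + b2 ^ 2 ≤ M := (le_max_left _ _).trans (le_max_right _ _)
  have m3' : a3 ^ 2 + b3 ^ 2 ≤ M := (le_max_right _ _).trans (le_max_right _ _)
  have e : α * M + β * M + γ * M = M := by rw [← add_mul, ← add_mul, hsum, one_mul]
  have := mul_le_mul_of_nonneg_left m1' hα
  have := mul_le_mul_of_nonneg_left m2' hβ
  have := mul_le_mul_of_nonneg_left m3' hγ
  linarith

lemma N2_E {ε : ℝ} (hε : 0 < ε) {p : ℝ × ℝ} (hp : p ∈ N2 ε) :
    (p.1 ^ 2 - p.2 ^ 2) ^ 2 + (2 * p.1 * p.2) ^ 2 < ε ^ 4 := by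
  have h := pow_lt_pow_left₀ hp.2 hp.1.le (n := 2) (by norm_num)
  nlinarith

/-- Straight segment in null coordinates. -/
lemma chron_line (ζ ε : ℝ) (hζ : 1 < ζ) (hε : 0 < ε) (p q : ℝ × ℝ) (hpN : p ∈ N2 ε)
    (hqN : q ∈ N2 ε) (hp : 0 < p.1 + p.2) (hq : 0 < q.1 + q.2)
    (hu : uu ζ q < uu ζ p) (hv : vv ζ q < vv ζ p) (hvp : vv ζ p ≤ 0) : chron2 ζ ε p q := by
  have s0 : 0 < Real.sqrt (ζ - 1) := Real.sqrt_pos.2 (by linarith)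
  have hd : ∀ c d t : ℝ, HasDerivAt (fun t : ℝ => (1 - t) * c + t * d) (d - c) t := by
    intro c d t
    have := (((hasDerivAt_id t).const_sub 1).mul_const c).add ((hasDerivAt_id t).mul_const d)
    exact this.congr_deriv (by ring)
  refine lift_curve ζ ε hζ hε p q hp hq
    (fun t => (1 - t) * (p.1 ^ 2 - p.2 ^ 2) + t * (q.1 ^ 2 - q.2 ^ 2))
    (fun t => (1 - t) * (2 * p.1 * p.2) + t * (2 * q.1 * q.2))
    (fun _ => (q.1 ^ 2 - q.2 ^ 2) - (p.1 ^ 2 - p.2 ^ 2))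
    (fun _ => (2 * q.1 * q.2) - (2 * p.1 * p.2)) (hd _ _) (hd _ _)
    continuous_const continuous_const (by ring) (by ring) (by ring) (by ring) ?_ ?_ ?_ ?_
  · intro t ht
    have := conv3 (ε ^ 4) (1 - t) 0 t (p.1 ^ 2 - p.2 ^ 2) (2 * p.1 * p.2) 0 0 (q.1 ^ 2 - q.2 ^ 2)
      (2 * q.1 * q.2) (by linarith [ht.2]) le_rfl ht.1 (by ring) (N2_E hε hpN)
      (by rw [zero_pow two_ne_zero, add_zero]; positivity) (N2_E hε hqN)
    simpa using this
  · intro t ht hA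
    simp only [vv] at hv hvp
    beta_reduce at hA ⊢
    rcases ht.1.lt_or_eq with h | h
    · have h1 : (1 - t) * (Real.sqrt (ζ - 1) * (p.1 ^ 2 - p.2 ^ 2) - 2 * p.1 * p.2) ≤ 0 :=
        mul_nonpos_of_nonneg_of_nonpos (by linarith [ht.2]) hvp
      have h2 : t * (Real.sqrt (ζ - 1) * (q.1 ^ 2 - q.2 ^ 2) - 2 * q.1 * q.2) < 0 :=
        mul_neg_of_pos_of_neg h (by linarith)
      have h3 : Real.sqrt (ζ - 1) * ((1 - t) * (p.1 ^ 2 - p.2 ^ 2) + t * (q.1 ^ 2 - q.2 ^ 2)) = 0 := by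
        rw [hA, mul_zero]
      linarith
    · subst h
      have hA' : p.1 ^ 2 - p.2 ^ 2 = 0 := by linarith
      have h4 : (p.1 + p.2) * (p.1 - p.2) = 0 := by linarith
      have h5 : p.1 = p.2 := by
        rcases mul_eq_zero.1 h4 with h | h <;> linarith
      rw [h5] at hp ⊢
      have : 0 < p.2 := by linarith
      have : 0 < p.2 * p.2 := by positivity
      linarith
  · intro t _
    simp only [uu] at hu
    beta_reduce
    linarith
  · intro t _
    simp only [vv] at hv
    beta_reduce
    linarith

/-- Bent curve, from the past region around the left of the origin. -/
lemma chron_bend (ζ ε : ℝ) (hζ : 1 < ζ) (hε : 0 < ε) (p q : ℝ × ℝ) (hpN : p ∈ N2 ε)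
    (hqN : q ∈ N2 ε) (hp : 0 < p.1 + p.2) (hq : 0 < q.1 + q.2)
    (hup : 0 < uu ζ p) (hvp : 0 < vv ζ p) (huq : uu ζ q < 0) (hvq : vv ζ q < 0) :
    chron2 ζ ε p q := by
  have s0 : 0 < Real.sqrt (ζ - 1) := Real.sqrt_pos.2 (by linarith)
  simp only [uu, vv] at hup hvp huq hvq
  have hEp := N2_E hε hpN
  have hEq := N2_E hε hqN
  set s := Real.sqrt (ζ - 1)
  obtain ⟨Ap, hAp⟩ : ∃ a, a = p.1 ^ 2 - p.2 ^ 2 := ⟨_, rfl⟩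
  obtain ⟨Aq, hAq⟩ : ∃ a, a = q.1 ^ 2 - q.2 ^ 2 := ⟨_, rfl⟩
  obtain ⟨Bp, hBp⟩ : ∃ a, a = 2 * p.1 * p.2 := ⟨_, rfl⟩
  obtain ⟨Bq, hBq⟩ : ∃ a, a = 2 * q.1 * q.2 := ⟨_, rfl⟩
  rw [← hAp, ← hBp] at hup hvp hEp
  rw [← hAq, ← hBq] at huq hvq hEq
  have Ap0 : 0 < Ap := by
    by_contra hc
    push Not at hc
    nlinarith
  have Aq0 : Aq < 0 := by
    by_contra hc
    push Not at hc
    nlinarith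
  obtain ⟨δ, hδ0, hδ⟩ : ∃ δ, 0 < δ ∧ δ < min (s * Ap + Bp) (min (-(s * Aq - Bq)) (ε ^ 2)) :=
    exists_between (lt_min hup (lt_min (by linarith) (by positivity)))
  obtain ⟨hδ1, hδ'⟩ := lt_min_iff.1 hδ
  obtain ⟨hδ2, hδ3⟩ := lt_min_iff.1 hδ'
  set K := δ + |Bp| + |Bq| with hK
  have hK0 : 0 < K := by positivity
  set C := 1 + (-Aq) / Ap + Ap / (-Aq) with hC
  have Aq1 : 0 < -Aq := by linarith
  have hC0 : 0 < C := by positivity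
  obtain ⟨n, hn⟩ := exists_pow_lt_of_lt_one (show 0 < δ / (K * C) by positivity)
    (show (1 / 2 : ℝ) < 1 by norm_num)
  have hn1 : (1 / 2 : ℝ) ^ (n + 1) * (K * C) < δ := by
    have h1 : (1 / 2 : ℝ) ^ (n + 1) ≤ (1 / 2) ^ n :=
      pow_le_pow_of_le_one (by norm_num) (by norm_num) (Nat.le_succ n)
    rw [lt_div_iff₀ (by positivity)] at hn
    exact (mul_le_mul_of_nonneg_right h1 (by positivity)).trans_lt hn
  have hd : ∀ c b d t : ℝ, HasDerivAt
      (fun t : ℝ => (1 - t) ^ (n + 1) * c + (1 - (1 - t) ^ (n + 1) - t ^ (n + 1)) * b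
        + t ^ (n + 1) * d) ((n + 1) * (-(1 - t) ^ n * (c - b) + t ^ n * (d - b))) t := by
    intro c b d t
    have h1 : HasDerivAt (fun t : ℝ => (1 - t) ^ (n + 1)) (-((n + 1) * (1 - t) ^ n)) t := by
      have := ((hasDerivAt_id t).const_sub 1).pow (n + 1)
      exact this.congr_deriv (by simp)
    have h2 : HasDerivAt (fun t : ℝ => t ^ (n + 1)) ((n + 1) * t ^ n) t := by
      have := hasDerivAt_pow (n + 1) t
      simpa using this
    have := ((h1.mul_const c).add (((h1.const_sub 1).sub h2).mul_const b)).add (h2.mul_const d)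
    exact this.congr_deriv (by ring)
  have wts : ∀ t ∈ Icc (0 : ℝ) 1, 0 ≤ (1 - t) ^ (n + 1) ∧ 0 ≤ t ^ (n + 1) ∧
      0 ≤ 1 - (1 - t) ^ (n + 1) - t ^ (n + 1) := by
    intro t ht
    have h1 : 0 ≤ 1 - t := by linarith [ht.2]
    have h2 := ht.1
    refine ⟨by positivity, by positivity, ?_⟩
    have e1 : (1 - t) ^ (n + 1) ≤ 1 - t := pow_le_of_le_one h1 (by linarith) (by simp)
    have e2 : t ^ (n + 1) ≤ t := pow_le_of_le_one h2 ht.2 (by simp)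
    linarith
  have dneg : ∀ t ∈ Icc (0 : ℝ) 1, ∀ a b : ℝ, 0 < a → b < 0 →
      ((n : ℝ) + 1) * (-(1 - t) ^ n * a + t ^ n * b) < 0 := by
    intro t ht a b ha hb
    have h1 : 0 ≤ 1 - t := by linarith [ht.2]
    have h2 := ht.1
    apply mul_neg_of_pos_of_neg (by positivity)
    have e1 : 0 ≤ (1 - t) ^ n * a := by positivity
    have e2 : t ^ n * b ≤ 0 := mul_nonpos_of_nonneg_of_nonpos (by positivity) hb.le
    rcases h2.lt_or_eq with h | h
    · have : t ^ n * b < 0 := mul_neg_of_pos_of_neg (by positivity) hb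
      linarith
    · have : 0 < (1 - t) ^ n * a := by rw [← h]; simpa using ha
      linarith
  refine lift_curve ζ ε hζ hε p q hp hq
    (fun t : ℝ => (1 - t) ^ (n + 1) * Ap + (1 - (1 - t) ^ (n + 1) - t ^ (n + 1)) * 0
        + t ^ (n + 1) * Aq)
    (fun t : ℝ => (1 - t) ^ (n + 1) * Bp + (1 - (1 - t) ^ (n + 1) - t ^ (n + 1)) * δ
        + t ^ (n + 1) * Bq)
    _ _ (hd _ _ _) (hd _ _ _) (by fun_prop) (by fun_prop) (by simp [hAp]) (by simp [hBp])
    (by simp [hAq]) (by simp [hBq]) ?_ ?_ ?_ ?_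
  · intro t ht
    obtain ⟨w1, w2, w3⟩ := wts t ht
    refine conv3 (ε ^ 4) _ _ _ _ _ _ _ _ _ w1 w3 w2 (by ring) hEp ?_ hEq
    have := pow_lt_pow_left₀ hδ3 hδ0.le (n := 2) (by norm_num)
    nlinarith
  · intro t ht hA
    obtain ⟨w1, w2, w3⟩ := wts t ht
    beta_reduce at hA ⊢
    obtain ⟨α, hα⟩ : ∃ a, a = (1 - t) ^ (n + 1) := ⟨_, rfl⟩
    obtain ⟨γ, hγ⟩ : ∃ a, a = t ^ (n + 1) := ⟨_, rfl⟩
    have hh : 0 < (1 / 2 : ℝ) ^ (n + 1) := by positivity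
    have hsum : α + γ ≤ C * (1 / 2) ^ (n + 1) := by
      have hx1 : 0 < (-Aq) / Ap := by positivity
      have hx2 : 0 < Ap / (-Aq) := by positivity
      have ea : α = (-Aq) / Ap * γ := by
        rw [hα, hγ]; field_simp; linarith
      have eg : γ = Ap / (-Aq) * α := by
        have hne : Aq ≠ 0 := Aq0.ne
        rw [ea]; field_simp
      have hor : γ ≤ (1 / 2) ^ (n + 1) ∨ α ≤ (1 / 2) ^ (n + 1) := by
        rcases le_total t (1 / 2) with h | h
        · left; rw [hγ]; exact pow_le_pow_left₀ ht.1 h _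
        · right; rw [hα]; exact pow_le_pow_left₀ (by linarith [ht.2]) (by linarith) _
      rcases hor with h | h
      · have := mul_le_mul_of_nonneg_left h hx1.le
        have := mul_pos hx2 hh
        rw [hC]; linarith
      · have := mul_le_mul_of_nonneg_left h hx2.le
        have := mul_pos hx1 hh
        rw [hC]; linarith
    rw [← hα] at w1 ⊢
    rw [← hγ] at w2 ⊢
    have k1 : (α + γ) * K < δ := by
      have := mul_le_mul_of_nonneg_right hsum hK0.le
      linarith
    have k2 : -(α * |Bp|) ≤ α * Bp := by
      have := mul_le_mul_of_nonneg_left (neg_abs_le Bp) w1; linarith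
    have k3 : -(γ * |Bq|) ≤ γ * Bq := by
      have := mul_le_mul_of_nonneg_left (neg_abs_le Bq) w2; linarith
    have k4 : 0 ≤ α * |Bq| := by positivity
    have k5 : 0 ≤ γ * |Bp| := by positivity
    rw [hK] at k1
    linarith
  · intro t ht
    have := dneg t ht (s * Ap + Bp - δ) (s * Aq + Bq - δ) (by linarith) (by linarith)
    linarith
  · intro t ht
    have := dneg t ht (s * Ap - Bp + δ) (s * Aq - Bq + δ) (by linarith) (by linarith)
    linarith

/-- Along a timelike curve both null coordinates strictly decrease. -/
lemma curve_anti (ζ ε : ℝ) (hζ : 1 < ζ) (γ γ' : ℝ → ℝ × ℝ) (h : Timelike2 ζ ε γ γ') :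
    StrictAntiOn (fun t => uu ζ (γ t)) (Icc 0 1) ∧
    StrictAntiOn (fun t => vv ζ (γ t)) (Icc 0 1) := by
  obtain ⟨h1, h2, h3, h4, h5⟩ := h
  have s0 : 0 < Real.sqrt (ζ - 1) := Real.sqrt_pos.2 (by linarith)
  have s2 : Real.sqrt (ζ - 1) ^ 2 = ζ - 1 := Real.sq_sqrt (by linarith)
  set s := Real.sqrt (ζ - 1) with hs
  have hx : ∀ t ∈ Icc (0 : ℝ) 1, HasDerivAt (fun t => (γ t).1) (γ' t).1 t := fun t ht =>
    (hasFDerivAt_fst (𝕜 := ℝ) (p := γ t)).comp_hasDerivAt (f := γ) t (h1 t ht)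
  have hy : ∀ t ∈ Icc (0 : ℝ) 1, HasDerivAt (fun t => (γ t).2) (γ' t).2 t := fun t ht =>
    (hasFDerivAt_snd (𝕜 := ℝ) (p := γ t)).comp_hasDerivAt (f := γ) t (h1 t ht)
  have key : ∀ t ∈ Icc (0 : ℝ) 1,
      s * ((γ t).1 * (γ' t).1 - (γ t).2 * (γ' t).2) + ((γ t).1 * (γ' t).2 + (γ t).2 * (γ' t).1) < 0 ∧
      s * ((γ t).1 * (γ' t).1 - (γ t).2 * (γ' t).2) - ((γ t).1 * (γ' t).2 + (γ t).2 * (γ' t).1) < 0 := by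
    intro t ht
    have a5 := h5 t ht
    have a4 := h4 t ht
    obtain ⟨a, ha⟩ : ∃ a, a = (γ t).1 * (γ' t).1 - (γ t).2 * (γ' t).2 := ⟨_, rfl⟩
    obtain ⟨b, hb⟩ : ∃ b, b = (γ t).1 * (γ' t).2 + (γ t).2 * (γ' t).1 := ⟨_, rfl⟩
    have e : g2 ζ (γ t) (γ' t) = 4 * (b ^ 2 - s ^ 2 * a ^ 2) := by
      rw [s2, ha, hb]; simp only [g2]; ring
    rw [e] at a4
    rw [← ha, ← hb]
    have ha0 : a < 0 := by rw [ha]; linarith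
    have hsa : 0 < -(s * a) := by have := mul_neg_of_pos_of_neg s0 ha0; linarith
    have hlt : |b| < -(s * a) := abs_lt_of_sq_lt_sq (by nlinarith) hsa.le
    obtain ⟨l1, l2⟩ := abs_lt.1 hlt
    constructor <;> linarith
  have du : ∀ t ∈ Icc (0 : ℝ) 1, HasDerivAt (fun t => uu ζ (γ t))
      (2 * (s * ((γ t).1 * (γ' t).1 - (γ t).2 * (γ' t).2) +
        ((γ t).1 * (γ' t).2 + (γ t).2 * (γ' t).1))) t := by
    intro t ht
    have := ((((hx t ht).pow 2).sub ((hy t ht).pow 2)).const_mul s).add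
      (((hx t ht).const_mul 2).mul (hy t ht))
    exact this.congr_deriv (by norm_num; ring)
  have dv : ∀ t ∈ Icc (0 : ℝ) 1, HasDerivAt (fun t => vv ζ (γ t))
      (2 * (s * ((γ t).1 * (γ' t).1 - (γ t).2 * (γ' t).2) -
        ((γ t).1 * (γ' t).2 + (γ t).2 * (γ' t).1))) t := by
    intro t ht
    have := ((((hx t ht).pow 2).sub ((hy t ht).pow 2)).const_mul s).sub
      (((hx t ht).const_mul 2).mul (hy t ht))
    exact this.congr_deriv (by norm_num; ring)
  constructor
  · apply strictAntiOn_of_deriv_neg (convex_Icc 0 1)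
    · exact fun t ht => (du t ht).continuousAt.continuousWithinAt
    · intro t ht
      have ht' := interior_subset ht
      rw [(du t ht').deriv]
      linarith [(key t ht').1]
  · apply strictAntiOn_of_deriv_neg (convex_Icc 0 1)
    · exact fun t ht => (dv t ht).continuousAt.continuousWithinAt
    · intro t ht
      have ht' := interior_subset ht
      rw [(dv t ht').deriv]
      linarith [(key t ht').2]

/-- If `y` never vanishes along the curve, its sign is constant. -/
lemma sign_const (ζ ε : ℝ) (γ γ' : ℝ → ℝ × ℝ) (h : Timelike2 ζ ε γ γ')
    (hne : ∀ t ∈ Icc (0 : ℝ) 1, (γ t).2 ≠ 0) : 0 < (γ 0).2 ↔ 0 < (γ 1).2 := by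
  have hc : ContinuousOn (fun t => (γ t).2) (Icc 0 1) := fun t ht =>
    (continuous_snd.continuousAt.comp (h.1 t ht).continuousAt).continuousWithinAt
  have n0 := hne 0 (by simp)
  have n1 := hne 1 (by simp)
  constructor
  · intro h0
    by_contra h1
    obtain ⟨t, ht, e⟩ := intermediate_value_Icc' (zero_le_one) hc
      (show (0 : ℝ) ∈ Icc _ _ from ⟨not_lt.1 h1, h0.le⟩)
    exact hne t ht e
  · intro h1
    by_contra h0
    obtain ⟨t, ht, e⟩ := intermediate_value_Icc (zero_le_one) hc
      (show (0 : ℝ) ∈ Icc _ _ from ⟨not_lt.1 h0, h1.le⟩)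
    exact hne t ht e

lemma y_ne_of_u {ζ ε : ℝ} (hζ : 1 < ζ) {p : ℝ × ℝ} (hp : p ∈ N2 ε)
    (h : uu ζ p ≤ 0 ∨ vv ζ p ≤ 0) : p.2 ≠ 0 := by
  intro h0
  have s0 : 0 < Real.sqrt (ζ - 1) := Real.sqrt_pos.2 (by linarith)
  have h1 := hp.1
  rw [h0] at h1
  have h2 : 0 < p.1 ^ 2 := by linarith
  have h3 := mul_pos s0 h2
  simp only [uu, vv, h0] at h
  rcases h with h | h <;> linarith

/-- Factorisations of the null coordinates, and slopes. -/
lemma slopes (ζ : ℝ) (hζ : 1 < ζ) :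
    0 < m1 ζ ∧ m1 ζ < 1 ∧ 1 < m2 ζ ∧
    (∀ p, uu ζ p = Real.sqrt (ζ - 1) * ((m2 ζ * p.1 - p.2) * (p.2 + m1 ζ * p.1))) ∧
    (∀ p, vv ζ p = Real.sqrt (ζ - 1) * ((m2 ζ * p.1 + p.2) * (m1 ζ * p.1 - p.2))) := by
  have s0 : 0 < Real.sqrt (ζ - 1) := Real.sqrt_pos.2 (by linarith)
  have s2 : Real.sqrt (ζ - 1) ^ 2 = ζ - 1 := Real.sq_sqrt (by linarith)
  have r2 : Real.sqrt ζ ^ 2 = ζ := Real.sq_sqrt (by linarith)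
  have r0 : 0 ≤ Real.sqrt ζ := Real.sqrt_nonneg _
  have r1 : 1 < Real.sqrt ζ := by
    rw [Real.lt_sqrt (by norm_num)]; linarith
  have e12 : m1 ζ * m2 ζ = 1 := by
    simp only [m1, m2]; field_simp; nlinarith
  have ed : Real.sqrt (ζ - 1) * (m2 ζ - m1 ζ) = 2 := by
    simp only [m1, m2]; field_simp; ring
  have h1 : 0 < m1 ζ := div_pos (by linarith) s0
  have h2 : 0 < m2 ζ := div_pos (by linarith) s0
  have hlt : m1 ζ < m2 ζ := by
    by_contra hc
    push Not at hc
    nlinarith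
  refine ⟨h1, by nlinarith, by nlinarith, ?_, ?_⟩
  · intro p
    simp only [uu]
    linear_combination (-(p.1 * p.2)) * ed - Real.sqrt (ζ - 1) * p.1 ^ 2 * e12
  · intro p
    simp only [vv]
    linear_combination (p.1 * p.2) * ed - Real.sqrt (ζ - 1) * p.1 ^ 2 * e12

lemma F1_iff (ζ : ℝ) (hζ : 1 < ζ) (p : ℝ × ℝ) :
    m2 ζ * |p.1| < p.2 ↔ 0 < p.2 ∧ uu ζ p < 0 ∧ vv ζ p < 0 := by
  obtain ⟨a1, a2, a3, hu, hv⟩ := slopes ζ hζ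
  have s0 : 0 < Real.sqrt (ζ - 1) := Real.sqrt_pos.2 (by linarith)
  rw [hu, hv]
  constructor
  · intro h
    have hp : 0 < p.2 := lt_of_le_of_lt (by positivity) h
    have b1 : m2 ζ * p.1 ≤ m2 ζ * |p.1| := mul_le_mul_of_nonneg_left (le_abs_self _) (by linarith)
    have b2 : m2 ζ * (-p.1) ≤ m2 ζ * |p.1| := mul_le_mul_of_nonneg_left (neg_le_abs _) (by linarith)
    have b3 : m1 ζ * p.1 ≤ m1 ζ * |p.1| := mul_le_mul_of_nonneg_left (le_abs_self _) (by linarith)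
    have b4 : m1 ζ * (-p.1) ≤ m1 ζ * |p.1| := mul_le_mul_of_nonneg_left (neg_le_abs _) (by linarith)
    have b5 : m1 ζ * |p.1| ≤ m2 ζ * |p.1| := mul_le_mul_of_nonneg_right (by linarith) (abs_nonneg _)
    refine ⟨hp, mul_neg_of_pos_of_neg s0 (mul_neg_of_neg_of_pos ?_ ?_),
      mul_neg_of_pos_of_neg s0 (mul_neg_of_pos_of_neg ?_ ?_)⟩ <;> linarith
  · rintro ⟨h1, h2, h3⟩
    have h2' := neg_of_mul_neg_right h2 s0.le
    have h3' := neg_of_mul_neg_right h3 s0.le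
    rcases abs_cases p.1 with ⟨e, h⟩ | ⟨e, h⟩
    · rw [e]
      have : 0 ≤ m1 ζ * p.1 := by positivity
      have := neg_of_mul_neg_left h2' (by linarith)
      linarith
    · rw [e]
      have : m1 ζ * p.1 < 0 := mul_neg_of_pos_of_neg a1 h
      by_contra hc
      have := mul_nonneg_of_nonpos_of_nonpos (show m2 ζ * p.1 + p.2 ≤ 0 by linarith)
        (show m1 ζ * p.1 - p.2 ≤ 0 by linarith)
      linarith

lemma P_iff (ζ : ℝ) (hζ : 1 < ζ) (p : ℝ × ℝ) :
    |p.2| < m1 ζ * |p.1| ↔ 0 < uu ζ p ∧ 0 < vv ζ p := by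
  obtain ⟨a1, a2, a3, hu, hv⟩ := slopes ζ hζ
  have s0 : 0 < Real.sqrt (ζ - 1) := Real.sqrt_pos.2 (by linarith)
  have a4 : 0 < m2 ζ := by linarith
  rw [hu, hv, mul_pos_iff_of_pos_left s0, mul_pos_iff_of_pos_left s0, mul_pos_iff, mul_pos_iff,
    abs_lt]
  rcases abs_cases p.1 with ⟨e, h⟩ | ⟨e, h⟩
  · rw [e]
    have b1 : m1 ζ * p.1 ≤ m2 ζ * p.1 := mul_le_mul_of_nonneg_right (by linarith) h
    have b2 : 0 ≤ m1 ζ * p.1 := by positivity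
    constructor
    · rintro ⟨c1, c2⟩
      exact ⟨Or.inl ⟨by linarith, by linarith⟩, Or.inl ⟨by linarith, by linarith⟩⟩
    · rintro ⟨⟨c1, c2⟩ | ⟨c1, c2⟩, ⟨c3, c4⟩ | ⟨c3, c4⟩⟩ <;> constructor <;> linarith
  · rw [e]
    have b1 : m2 ζ * p.1 ≤ m1 ζ * p.1 := by nlinarith
    have b2 : m1 ζ * p.1 < 0 := mul_neg_of_pos_of_neg a1 h
    constructor
    · rintro ⟨c1, c2⟩
      exact ⟨Or.inr ⟨by linarith, by linarith⟩, Or.inr ⟨by linarith, by linarith⟩⟩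
    · rintro ⟨⟨c1, c2⟩ | ⟨c1, c2⟩, ⟨c3, c4⟩ | ⟨c3, c4⟩⟩ <;> constructor <;> linarith

lemma F1_sum (ζ : ℝ) (hζ : 1 < ζ) (p : ℝ × ℝ) (h : m2 ζ * |p.1| < p.2) : 0 < p.1 + p.2 := by
  obtain ⟨a1, a2, a3, -, -⟩ := slopes ζ hζ
  have : |p.1| ≤ m2 ζ * |p.1| := le_mul_of_one_le_left (abs_nonneg _) a3.le
  linarith [neg_abs_le p.1]

/-- Existence of a curve to `q ∈ F₁` from `p` in the right half. -/
lemma chron_right (ζ ε : ℝ) (hζ : 1 < ζ) (hε : 0 < ε) (p q : ℝ × ℝ) (hpN : p ∈ N2 ε)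
    (hqN : q ∈ N2 ε) (hqF : m2 ζ * |q.1| < q.2) (hx : 0 ≤ p.1)
    (hu : uu ζ q < uu ζ p) (hv : vv ζ q < vv ζ p)
    (hw : 0 < p.2 ∨ |p.2| < m1 ζ * |p.1|) : chron2 ζ ε p q := by
  obtain ⟨a1, a2, a3, -, -⟩ := slopes ζ hζ
  obtain ⟨q0, q1, q2⟩ := (F1_iff ζ hζ q).1 hqF
  have hqs := F1_sum ζ hζ q hqF
  have hps : 0 < p.1 + p.2 := by
    rcases hw with h | h
    · linarith
    · rw [abs_of_nonneg hx] at h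
      have : m1 ζ * p.1 ≤ p.1 := mul_le_of_le_one_left hx a2.le
      linarith [neg_abs_le p.2]
  rcases le_or_gt (vv ζ p) 0 with h | h
  · exact chron_line ζ ε hζ hε p q hpN hqN hps hqs hu hv h
  · have hup : 0 < uu ζ p := by
      rcases hw with h' | h'
      · have : uu ζ p = vv ζ p + 4 * (p.1 * p.2) := by simp only [uu, vv]; ring
        have : 0 ≤ p.1 * p.2 := by positivity
        linarith
      · exact ((P_iff ζ hζ p).1 h').1
    exact chron_bend ζ ε hζ hε p q hpN hqN hps hqs hup h q1 q2

lemma chron_past (ζ ε : ℝ) (hζ : 1 < ζ) (hε : 0 < ε) (p q : ℝ × ℝ) (hpN : p ∈ N2 ε)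
    (hqN : q ∈ N2 ε) (hqF : m2 ζ * |q.1| < q.2)
    (hu : uu ζ q < uu ζ p) (hv : vv ζ q < vv ζ p)
    (hw : 0 < p.2 ∨ |p.2| < m1 ζ * |p.1|) : chron2 ζ ε p q := by
  rcases le_total 0 p.1 with hx | hx
  · exact chron_right ζ ε hζ hε p q hpN hqN hqF hx hu hv hw
  · apply mirror_chron
    have eu : ∀ r : ℝ × ℝ, uu ζ (-r.1, r.2) = vv ζ r := by
      intro r; simp only [uu, vv]; ring
    have ev : ∀ r : ℝ × ℝ, vv ζ (-r.1, r.2) = uu ζ r := by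
      intro r; simp only [uu, vv]; ring
    apply chron_right ζ ε hζ hε
    · simpa [N2] using hpN
    · simpa [N2] using hqN
    · simpa using hqF
    · simpa using hx
    · rw [eu, eu]; exact hv
    · rw [ev, ev]; exact hu
    · simpa using hw

/-- for `q` in the upper future component `F₁ = {y > m₂|x|}` of the
trousers (so `u(q) < 0` and `v(q) < 0`), `I⁺(q)` is the region above the `x`-axis
bounded by the null hyperbolae through `q` (contained in `F₁`), and `I⁻(q)` is the
region bounded by those hyperbolae minus the wedge `{p₂ ≤ 0, |p₂| ≥ m₁|p₁|}`;
in particular `P ⊆ I⁻(q)` and `I⁻(q) ∩ F₂ = ∅`. -/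
theorem stmt2 (ζ ε : ℝ) (hζ : 1 < ζ) (hε : 0 < ε) (q : ℝ × ℝ) (hq : q ∈ N2 ε)
    (hqF1 : m2 ζ * |q.1| < q.2) :
    uu ζ q < 0 ∧ vv ζ q < 0 ∧
    Iplus2 ζ ε q = {p ∈ N2 ε | 0 < p.2 ∧ uu ζ p < uu ζ q ∧ vv ζ p < vv ζ q} ∧
    Iplus2 ζ ε q ⊆ {p ∈ N2 ε | m2 ζ * |p.1| < p.2} ∧
    Iminus2 ζ ε q =
      {p ∈ N2 ε | uu ζ q < uu ζ p ∧ vv ζ q < vv ζ p} \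
        {p : ℝ × ℝ | p.2 ≤ 0 ∧ m1 ζ * |p.1| ≤ |p.2|} ∧
    {p ∈ N2 ε | |p.2| < m1 ζ * |p.1|} ⊆ Iminus2 ζ ε q ∧
    (∀ p ∈ Iminus2 ζ ε q, ¬ p.2 < -(m2 ζ * |p.1|)) := by
  obtain ⟨a1, a2, a3, -, -⟩ := slopes ζ hζ
  obtain ⟨q0, q1, q2⟩ := (F1_iff ζ hζ q).1 hqF1
  have hplus : Iplus2 ζ ε q = {p ∈ N2 ε | 0 < p.2 ∧ uu ζ p < uu ζ q ∧ vv ζ p < vv ζ q} := by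
    ext p
    constructor
    · rintro ⟨hpN, γ, γ', hγ, e0, e1⟩
      obtain ⟨hu, hv⟩ := curve_anti ζ ε hζ γ γ' hγ
      have l0 : (0 : ℝ) ∈ Icc (0 : ℝ) 1 := by simp
      have l1 : (1 : ℝ) ∈ Icc (0 : ℝ) 1 := by simp
      have hu1 := hu l0 l1 zero_lt_one
      have hv1 := hv l0 l1 zero_lt_one
      simp only [e0, e1] at hu1 hv1
      refine ⟨hpN, ?_, hu1, hv1⟩
      have hs := sign_const ζ ε γ γ' hγ (fun t ht => by
        apply y_ne_of_u hζ (hγ.2.2.1 t ht)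
        left
        have := hu.antitoneOn l0 ht ht.1
        simp only [e0] at this
        linarith)
      rw [e0, e1] at hs
      exact hs.1 q0
    · rintro ⟨hpN, p0, hu, hv⟩
      have hpF : m2 ζ * |p.1| < p.2 := (F1_iff ζ hζ p).2 ⟨p0, by linarith, by linarith⟩
      exact ⟨hpN, chron_past ζ ε hζ hε q p hq hpN hpF hu hv (Or.inl q0)⟩
  have hminus : Iminus2 ζ ε q =
      {p ∈ N2 ε | uu ζ q < uu ζ p ∧ vv ζ q < vv ζ p} \
        {p : ℝ × ℝ | p.2 ≤ 0 ∧ m1 ζ * |p.1| ≤ |p.2|} := by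
    ext p
    constructor
    · rintro ⟨hpN, γ, γ', hγ, e0, e1⟩
      obtain ⟨hu, hv⟩ := curve_anti ζ ε hζ γ γ' hγ
      have l0 : (0 : ℝ) ∈ Icc (0 : ℝ) 1 := by simp
      have l1 : (1 : ℝ) ∈ Icc (0 : ℝ) 1 := by simp
      have hu1 := hu l0 l1 zero_lt_one
      have hv1 := hv l0 l1 zero_lt_one
      simp only [e0, e1] at hu1 hv1
      refine ⟨⟨hpN, hu1, hv1⟩, ?_⟩
      rintro ⟨w1, w2⟩
      have hnP : uu ζ p ≤ 0 ∨ vv ζ p ≤ 0 := by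
        by_contra hc
        push Not at hc
        have := (P_iff ζ hζ p).2 hc
        linarith
      have hs := sign_const ζ ε γ γ' hγ (fun t ht => by
        apply y_ne_of_u hζ (hγ.2.2.1 t ht)
        have k1 := hu.antitoneOn l0 ht ht.1
        have k2 := hv.antitoneOn l0 ht ht.1
        simp only [e0] at k1 k2
        rcases hnP with h | h
        · left; linarith
        · right; linarith)
      rw [e0, e1] at hs
      linarith [hs.2 q0]
    · rintro ⟨⟨hpN, hu, hv⟩, hw⟩
      refine ⟨hpN, chron_past ζ ε hζ hε p q hpN hq hqF1 hu hv ?_⟩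
      by_contra hc
      push Not at hc
      exact hw hc
  refine ⟨q1, q2, hplus, ?_, hminus, ?_, ?_⟩
  · rw [hplus]
    rintro p ⟨hpN, p0, hu, hv⟩
    exact ⟨hpN, (F1_iff ζ hζ p).2 ⟨p0, by linarith, by linarith⟩⟩
  · rintro p ⟨hpN, hP⟩
    obtain ⟨k1, k2⟩ := (P_iff ζ hζ p).1 hP
    exact ⟨hpN, chron_past ζ ε hζ hε p q hpN hq hqF1 (by linarith) (by linarith) (Or.inr hP)⟩
  · intro p hp hF
    rw [hminus] at hp
    apply hp.2
    have k1 : 0 ≤ m2 ζ * |p.1| := by positivity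
    have k2 : m1 ζ * |p.1| ≤ m2 ζ * |p.1| :=
      mul_le_mul_of_nonneg_right (by linarith) (abs_nonneg _)
    have hn : p.2 ≤ 0 := by linarith
    refine ⟨hn, ?_⟩
    rw [abs_of_nonpos hn]
    linarith
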